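/- Let g ∈ ℚ[[X]] have constant coefficient 1, let f := −X·g, and for n, k ∈ ℕ let t(n,k) denote the coefficient of Xⁿ in g·(X·g)ᵏ (the (n,k) entry of the Bell-type Riordan array (g(x), xg(x))). Then g is involutory (i.e., f(f(X)) = X and g·g(f(X)) = 1, so that (g(x), xg(x)) is a Bell pseudo-involution) if and only if there exists a sequence b : ℕ → ℚ such that for all n, k ∈ ℕ: t(n+1, k) = t(n, k−1) + Σ_{j=0}^{n} b(j)·t(n−j, k+j), where the term t(n, k−1) is taken to be 0 when k = 0. (The sequence b(0), b(1), b(2), … is the B-sequence of the pseudo-involution.) -/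

import Mathlib

open PowerSeries

/-- Substitution of the power series `f` (intended: with zero constant coefficient) into the
power series `g`: the `n`-th coefficient of `g(f)` is `∑_{k=0}^{n} gₖ · [Xⁿ] fᵏ`. -/
noncomputable def substSeries (f g : PowerSeries ℚ) : PowerSeries ℚ :=
  PowerSeries.mk fun n => ∑ k ∈ Finset.range (n + 1), coeff k g * coeff n (f ^ k)

lemma aux_subst (f g : PowerSeries ℚ) (hf : constantCoeff f = 0) :
    substSeries f g = g.subst f := by
  have hs : HasSubst f := HasSubst.of_constantCoeff_zero' hf
  ext n
  rw [coeff_subst' hs, substSeries, coeff_mk, finsum_eq_sum_of_support_subset]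
  · rfl
  · intro k hk
    simp only [Function.mem_support, Finset.coe_range, Set.mem_Iio] at hk ⊢
    by_contra hlt
    apply hk
    have hX : (X : PowerSeries ℚ) ^ k ∣ f ^ k := pow_dvd_pow_of_dvd (X_dvd_iff.2 hf) k
    rw [X_pow_dvd_iff.1 hX n (by omega), smul_zero]

lemma aux_trunc (B u : PowerSeries ℚ) (hu : constantCoeff u = 0) (N : ℕ) :
    ∃ R : PowerSeries ℚ, B.subst u =
      ∑ j ∈ Finset.range N, C (coeff j B) * u ^ j + u ^ N * R := by
  have hs : HasSubst u := HasSubst.of_constantCoeff_zero' hu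
  induction N generalizing B with
  | zero => exact ⟨B.subst u, by simp⟩
  | succ N ih =>
    obtain ⟨R, hR⟩ := ih (mk fun p => coeff (p + 1) B)
    refine ⟨R, ?_⟩
    have hB : B.subst u = u * (mk fun p => coeff (p + 1) B).subst u + C (coeff 0 B) := by
      conv_lhs => rw [eq_X_mul_shift_add_const B]
      rw [subst_add hs, subst_mul hs, subst_X hs, subst_C]
      simp
      rfl
    rw [hB, hR, Finset.sum_range_succ', mul_add, Finset.mul_sum]
    simp only [coeff_mk, pow_succ, pow_zero]
    rw [Finset.sum_congr rfl (fun j _ => by ring : ∀ j ∈ Finset.range N,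
      u * (C (coeff (j + 1) B) * u ^ j) = C (coeff (j + 1) B) * (u ^ j * u))]
    ring

lemma aux_congr (H a b : PowerSeries ℚ) (ha : constantCoeff a = 0) (hb : constantCoeff b = 0)
    (n : ℕ) (h : X ^ n ∣ a - b) : X ^ n ∣ H.subst a - H.subst b := by
  obtain ⟨R, hR⟩ := aux_trunc H a ha n
  obtain ⟨S, hS⟩ := aux_trunc H b hb n
  have e : H.subst a - H.subst b = ∑ j ∈ Finset.range n, C (coeff j H) * (a ^ j - b ^ j)
      + (a ^ n * R - b ^ n * S) := by
    rw [hR, hS]; simp only [mul_sub, Finset.sum_sub_distrib]; ring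
  rw [e]
  refine dvd_add (Finset.dvd_sum fun j _ => ?_) (dvd_sub ?_ ?_)
  · exact Dvd.dvd.mul_left (h.trans (sub_dvd_pow_sub_pow a b j)) _
  · exact Dvd.dvd.mul_right (pow_dvd_pow_of_dvd (X_dvd_iff.2 ha) n) _
  · exact Dvd.dvd.mul_right (pow_dvd_pow_of_dvd (X_dvd_iff.2 hb) n) _

/-- Coefficient extraction from a truncated expansion in powers of `X * (X * g)`. -/
lemma aux_coeff (g s R : PowerSeries ℚ) (b : ℕ → ℚ) (n k : ℕ)
    (hs : s = ∑ j ∈ Finset.range (n + 1), C (b j) * (X * (X * g)) ^ j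
      + (X * (X * g)) ^ (n + 1) * R) :
    coeff n (g * (X * g) ^ k * s) =
      ∑ j ∈ Finset.range (n + 1), b j * coeff (n - j) (g * (X * g) ^ (k + j)) := by
  rw [hs, mul_add, map_add, Finset.mul_sum, map_sum]
  have h0 : coeff n (g * (X * g) ^ k * ((X * (X * g)) ^ (n + 1) * R)) = 0 := by
    have : (X : PowerSeries ℚ) ^ (n + 1) ∣ g * (X * g) ^ k * ((X * (X * g)) ^ (n + 1) * R) :=
      ⟨g * (X * g) ^ k * ((X * g) ^ (n + 1) * R), by rw [mul_pow X (X * g)]; ring⟩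
    exact X_pow_dvd_iff.1 this n (by omega)
  rw [h0, add_zero]
  refine Finset.sum_congr rfl fun j hj => ?_
  have hj' : j ≤ n := by simp at hj; omega
  have e : g * (X * g) ^ k * (C (b j) * (X * (X * g)) ^ j) =
      C (b j) * (X ^ j * (g * (X * g) ^ (k + j))) := by
    rw [mul_pow X (X * g), pow_add]; ring
  rw [e, coeff_C_mul, coeff_X_pow_mul', if_pos hj']

lemma aux_fwd (g : PowerSeries ℚ) (hg0 : constantCoeff g = 1)
    (h1 : (-(X * g)).subst (-(X * g)) = (X : PowerSeries ℚ))
    (h2 : g * g.subst (-(X * g)) = 1) :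
    ∃ b : ℕ → ℚ, ∃ s : PowerSeries ℚ, g = 1 + X * g * s ∧
      ∀ N, ∃ R, s = ∑ j ∈ Finset.range N, C (b j) * (X * (X * g)) ^ j
      + (X * (X * g)) ^ N * R := by
  set f : PowerSeries ℚ := -(X * g) with hf
  have hf0 : constantCoeff f = 0 := by simp [hf]
  have hs : HasSubst f := HasSubst.of_constantCoeff_zero' hf0
  have hgne : g ≠ 0 := by rintro rfl; simp at hg0
  have hginv : g * g⁻¹ = 1 := PowerSeries.mul_inv_cancel g (by rw [hg0]; exact one_ne_zero)
  have hu : X * (X * g) = -(X * f) := by rw [hf]; ring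
  have huinv : (X * (X * g)).subst f = X * (X * g) := by
    have hneg : (-(X * f)).subst f = -(f * f.subst f) := by
      have := map_neg (substAlgHom hs) (X * f)
      rw [coe_substAlgHom, subst_mul hs, subst_X hs] at this
      exact this
    rw [hu, hneg, h1]; ring
  have hune : X * (X * g) ≠ 0 := mul_ne_zero X_ne_zero (mul_ne_zero X_ne_zero hgne)
  -- step
  have step : ∀ s : PowerSeries ℚ, s.subst f = s →
      ∃ s' : PowerSeries ℚ, s'.subst f = s' ∧ s = C (constantCoeff s) + X * (X * g) * s' := by
    intro s hsi
    have hc1 : coeff 1 s = 0 := by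
      obtain ⟨R, hR⟩ := aux_trunc s f hf0 2
      rw [hsi] at hR
      have h := congrArg (coeff 1) hR
      have hz : coeff 1 (f ^ 2 * R) = 0 :=
        X_pow_dvd_iff.1 (Dvd.dvd.mul_right (pow_dvd_pow_of_dvd (X_dvd_iff.2 hf0) 2) R) 1
          (by norm_num)
      have hf1 : coeff 1 f = -1 := by
        rw [hf, map_neg, show (1 : ℕ) = 0 + 1 from rfl, coeff_succ_X_mul]; simp [hg0]
      simp only [map_add, hz, Finset.sum_range_succ, Finset.sum_range_zero, coeff_C_mul, pow_zero,
        pow_one, hf1] at h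
      simp [coeff_one] at h
      linarith
    have hd : X ^ 2 ∣ s - C (constantCoeff s) := by
      rw [X_pow_dvd_iff]
      intro m hm
      interval_cases m
      · simp
      · simp [hc1]
    obtain ⟨r, hr⟩ := hd
    have hr' : s = C (constantCoeff s) + X * (X * g) * (g⁻¹ * r) := by
      have : X * (X * g) * (g⁻¹ * r) = X ^ 2 * r * (g * g⁻¹) := by ring
      rw [this, hginv, mul_one, ← hr]; ring
    refine ⟨g⁻¹ * r, ?_, hr'⟩
    have h3 := congrArg (fun t : PowerSeries ℚ => t.subst f) hr'
    beta_reduce at h3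
    rw [subst_add hs, subst_mul hs, huinv, subst_C, hsi] at h3
    apply mul_left_cancel₀ hune
    have h4 := hr'.symm.trans h3
    exact (add_left_cancel h4).symm
  -- initial series
  obtain ⟨r, hr⟩ : X ∣ g - 1 := X_dvd_iff.2 (by simp [hg0])
  have hs0 : g = 1 + X * g * (g⁻¹ * r) := by
    have : X * g * (g⁻¹ * r) = X * r * (g * g⁻¹) := by ring
    rw [this, hginv, mul_one, ← hr]; ring
  set s0 := g⁻¹ * r
  have hs0i : s0.subst f = s0 := by
    have h3 := congrArg (fun t : PowerSeries ℚ => t.subst f) hs0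
    beta_reduce at h3
    rw [subst_add hs, subst_mul hs, subst_mul hs, subst_X hs] at h3
    have h1' : (1 : PowerSeries ℚ).subst f = (1 : PowerSeries ℚ) := by
      rw [← coe_substAlgHom hs, map_one]
    rw [h1'] at h3
    apply mul_left_cancel₀ (mul_ne_zero X_ne_zero hgne)
    have h5 : 1 = g + f * s0.subst f := by
      have := congrArg (fun t => g * t) h3
      beta_reduce at this
      linear_combination this + (f * s0.subst f - 1) * h2
    rw [hf] at h5 ⊢
    linear_combination h5 + hs0
  choose! nx hnx1 hnx2 using step
  let S : ℕ → PowerSeries ℚ := fun n => nx^[n] s0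
  have hS : ∀ n, (S n).subst f = S n := by
    intro n
    induction n with
    | zero => exact hs0i
    | succ n ih => simp only [S, Function.iterate_succ_apply']; exact hnx1 _ ih
  refine ⟨fun n => constantCoeff (S n), s0, hs0, fun N => ⟨S N, ?_⟩⟩
  induction N with
  | zero => simp [S]
  | succ N ih =>
    have e : S N = C (constantCoeff (S N)) + X * (X * g) * S (N + 1) := by
      have := hnx2 _ (hS N)
      simpa only [S, Function.iterate_succ_apply'] using this
    rw [Finset.sum_range_succ]
    linear_combination ih + (X * (X * g)) ^ N * e

lemma aux_bwd (g B : PowerSeries ℚ) 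
    (h : g = 1 + X * g * B.subst (X * (X * g))) :
    (-(X * g)).subst (-(X * g)) = (X : PowerSeries ℚ) ∧ g * g.subst (-(X * g)) = 1 := by
  set u : PowerSeries ℚ := X * (X * g) with hu
  set f : PowerSeries ℚ := -(X * g) with hf
  have hf0 : constantCoeff f = 0 := by simp [hf]
  have hs : HasSubst f := HasSubst.of_constantCoeff_zero' hf0
  have hu0 : constantCoeff u = 0 := by simp [hu]
  have hsu : HasSubst u := HasSubst.of_constantCoeff_zero' hu0
  have hfn : (-(X * g)).subst f = -(f * g.subst f) := by
    have := map_neg (substAlgHom hs) (X * g)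
    rw [coe_substAlgHom, subst_mul hs, subst_X hs] at this
    exact this
  set p := f.subst f with hp
  have hpe : p = -(f * g.subst f) := hfn
  have hv : u.subst f = -(f * p) := by
    rw [hu, subst_mul hs, subst_X hs, subst_mul hs, subst_X hs, hpe]; ring
  have hv0 : constantCoeff (u.subst f : PowerSeries ℚ) = 0 := by rw [hv]; simp [hf0]
  have hsv : HasSubst (u.subst f : PowerSeries ℚ) := HasSubst.of_constantCoeff_zero' hv0
  have e1 : X = -f - (X * B).subst u := by
    rw [subst_mul hsu, subst_X hsu, hu, hf]
    linear_combination (-X) * h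
  have e1' : X + f + (X * B).subst u = 0 := by linear_combination e1
  have e2 : f + p + (X * B).subst (u.subst f) = 0 := by
    have := congrArg (fun t : PowerSeries ℚ => t.subst f) e1'
    beta_reduce at this
    rw [subst_add hs, subst_add hs, subst_X hs, subst_comp_subst_apply hsu hs] at this
    rw [this, ← coe_substAlgHom hs, map_zero]
  have e3 : p - X = (X * B).subst u - (X * B).subst (u.subst f) := by
    linear_combination e2 - e1'
  have key : ∀ n, X ^ n ∣ p - X := by
    intro n
    induction n with
    | zero => simp
    | succ n ih =>
      rw [e3]
      apply aux_congr _ _ _ hu0 hv0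
      have : u - u.subst f = f * (p - X) := by rw [hv, hu, hf]; ring
      rw [this, pow_succ']
      exact mul_dvd_mul (X_dvd_iff.2 hf0) ih
  have hpX : p = X := by
    rw [← sub_eq_zero]
    ext n
    rw [X_pow_dvd_iff.1 (key (n + 1)) n (by omega), map_zero]
  refine ⟨hpX, ?_⟩
  apply mul_left_cancel₀ (X_ne_zero : (X : PowerSeries ℚ) ≠ 0)
  rw [hpX] at hpe
  rw [mul_one]
  conv_rhs => rw [hpe, hf]
  ring

/-- Let `g` have constant coefficient `1` and let `t(n,k) = [Xⁿ] g·(X·g)ᵏ` be the entries of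
the Bell array `(g(x), xg(x))`.  Then `g` is involutory (with `f := −X·g`, `f(f(X)) = X` and
`g·g(f(X)) = 1`) if and only if there is a `B`-sequence `b : ℕ → ℚ` with
`t(n+1,k) = t(n,k−1) + ∑_{j=0}^{n} b(j)·t(n−j,k+j)` for all `n, k`, where the term
`t(n,k−1)` is read as `0` when `k = 0`. -/
theorem stmt_9 (g : PowerSeries ℚ) (hg0 : constantCoeff g = 1) :
    (substSeries (-(X * g)) (-(X * g)) = X ∧ g * substSeries (-(X * g)) g = 1) ↔
      ∃ b : ℕ → ℚ, ∀ n k : ℕ,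
        coeff (n + 1) (g * (X * g) ^ k) =
          (if k = 0 then 0 else coeff n (g * (X * g) ^ (k - 1))) +
            ∑ j ∈ Finset.range (n + 1), b j * coeff (n - j) (g * (X * g) ^ (k + j)) := by
  rw [aux_subst _ _ (by simp), aux_subst _ _ (by simp)]
  constructor
  · rintro ⟨h1, h2⟩
    obtain ⟨b, s, hs, hN⟩ := aux_fwd g hg0 h1 h2
    refine ⟨b, fun n k => ?_⟩
    obtain ⟨R, hR⟩ := hN (n + 1)
    rw [← aux_coeff g s R b n k hR]
    have e : g * (X * g) ^ k = (X * g) ^ k + X * (g * (X * g) ^ k * s) := by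
      linear_combination (X * g) ^ k * hs
    conv_lhs => rw [e]
    rw [map_add, coeff_succ_X_mul]
    congr 1
    rcases k with _ | k
    · simp [coeff_one]
    · rw [if_neg (by omega), Nat.add_sub_cancel, pow_succ,
        show (X * g) ^ k * (X * g) = X * (g * (X * g) ^ k) by ring, coeff_succ_X_mul]
  · rintro ⟨b, hb⟩
    apply aux_bwd g (mk b)
    have hu0 : constantCoeff (X * (X * g)) = 0 := by simp
    ext n
    rcases n with _ | n
    · simp [hg0, mul_assoc]
    · obtain ⟨R, hR⟩ := aux_trunc (mk b) (X * (X * g)) hu0 (n + 1)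
      simp only [coeff_mk] at hR
      have h3 := hb n 0
      rw [← aux_coeff g _ R b n 0 hR] at h3
      rw [mul_assoc, map_add, coeff_succ_X_mul]
      simpa [coeff_one] using h3
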